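/- arXiv:math/0210019 — 4 statements merged into one kernel-verified Lean document; each statement's English description precedes it below -/
import Mathlib

section
/- Let q, p be differentiable real functions on an interval I with p(t) > 0 for all t ∈ I, satisfying the Hamiltonian Painlevé II system with parameter v₁ = 0: q'(t) = p(t) − q(t)² − t/2 and p'(t) = 2q(t)p(t). Define, via the change of variable T = −2^{−1/3}·t (so t = −2^{1/3}·T), the functions Q(T) = 2^{−1/6}·√(p(t)) and P(T) = −2^{−1/3}·( t/2 − p(t) + q(t)·√(2p(t)) ). Then (Q,P) satisfies the Hamiltonian Painlevé II system with parameter v₁ = 1/2: dQ/dT = P − Q² − T/2 and dP/dT = 2QP + 1/2. -/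
/-- **Gambier's transformation in canonical (Hamiltonian) variables for Painlevé II.**
If `(q, p)` (with `p > 0`) solves the Hamiltonian Painlevé II system with parameter
`v₁ = 0`, i.e. `q' = p - q² - t/2`, `p' = 2 q p`, then under the change of variable
`T = -2^(-1/3) t` the functions `Q(T) = 2^(-1/6) √(p(t))` and
`P(T) = -2^(-1/3) (t/2 - p(t) + q(t) √(2 p(t)))` solve the Hamiltonian Painlevé II
system with parameter `v₁ = 1/2`: `dQ/dT = P - Q² - T/2`, `dP/dT = 2 Q P + 1/2`. -/
theorem painleveII_gambier_hamiltonian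
    (I : Set ℝ) (hI : I.OrdConnected)
    (T : ℝ → ℝ) (hT : ∀ t, T t = -(2:ℝ) ^ (-1/3 : ℝ) * t)
    (q p q' p' : ℝ → ℝ)
    (hqd : ∀ t ∈ I, HasDerivAt q (q' t) t)
    (hpd : ∀ t ∈ I, HasDerivAt p (p' t) t)
    (hppos : ∀ t ∈ I, 0 < p t)
    (hq' : ∀ t ∈ I, q' t = p t - (q t) ^ 2 - t/2)
    (hp' : ∀ t ∈ I, p' t = 2 * q t * p t)
    (Q P : ℝ → ℝ)
    (hQ : ∀ t : ℝ, Q (T t) = (2:ℝ) ^ (-1/6 : ℝ) * Real.sqrt (p t))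
    (hP : ∀ t : ℝ, P (T t) =
      -(2:ℝ) ^ (-1/3 : ℝ) * (t/2 - p t + q t * Real.sqrt (2 * p t))) :
    ∀ t ∈ I,
      HasDerivAt Q (P (T t) - (Q (T t)) ^ 2 - T t / 2) (T t) ∧
      HasDerivAt P (2 * Q (T t) * P (T t) + 1/2) (T t) := by
  obtain ⟨c, hc⟩ : ∃ c : ℝ, c = (2:ℝ) ^ (-1/6 : ℝ) := ⟨_, rfl⟩
  have hc0 : 0 < c := hc ▸ by positivity
  have hc2 : (2:ℝ) ^ (-1/3 : ℝ) = c ^ 2 := by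
    rw [hc, ← Real.rpow_mul_natCast (by norm_num)]
    norm_num
  have hc6 : c ^ 6 = 1 / 2 := by
    rw [hc, ← Real.rpow_mul_natCast (by norm_num)]
    norm_num [Real.rpow_neg_one]
  have hsqrt2 : Real.sqrt 2 = 2 * c ^ 3 := by
    rw [Real.sqrt_eq_iff_mul_self_eq (by norm_num) (by positivity)]
    linear_combination -4 * hc6
  have hsqrt (x : ℝ) : Real.sqrt (2 * x) = 2 * c ^ 3 * Real.sqrt x := by
    rw [Real.sqrt_mul (by norm_num), hsqrt2]
  simp only [hc2] at hT hP
  simp only [← hc] at hQ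
  simp only [hsqrt] at hP
  have hTinv (x : ℝ) : T (-2 * c ^ 4 * x) = x := by
    rw [hT]
    linear_combination 2 * x * hc6
  have hinvT (t : ℝ) : -2 * c ^ 4 * T t = t := by
    rw [hT]
    linear_combination 2 * t * hc6
  have hQfun : Q = fun x => c * Real.sqrt (p (-2 * c ^ 4 * x)) := by
    funext x
    rw [← hQ, hTinv]
  have hPfun : P = fun x => (fun t => -c ^ 2 *
      (t / 2 - p t + q t * (2 * c ^ 3 * Real.sqrt (p t)))) (-2 * c ^ 4 * x) := by
    funext x
    simp only
    rw [← hP, hTinv]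
  intro t ht
  have hp0 := hppos t ht
  have hs : Real.sqrt (p t) ^ 2 = p t := Real.sq_sqrt hp0.le
  have hlin : HasDerivAt (fun x : ℝ => -2 * c ^ 4 * x) (-2 * c ^ 4) (T t) := by
    simpa only [id_eq, mul_one] using (hasDerivAt_id (T t)).const_mul (-2 * c ^ 4)
  have hsd : HasDerivAt (fun u => Real.sqrt (p u)) (q t * Real.sqrt (p t)) t := by
    have hs0 : Real.sqrt (p t) ≠ 0 := (Real.sqrt_pos.2 hp0).ne'
    convert (hpd t ht).sqrt hp0.ne' using 1
    rw [hp' t ht]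
    field_simp
    linear_combination q t * hs
  constructor
  · have h := (HasDerivAt.comp_of_eq (T t) hsd hlin (hinvT t).symm).const_mul c
    rw [hP, hQ, hQfun]
    refine HasDerivAt.congr_deriv h ?_
    rw [hT]
    linear_combination c ^ 2 * hs
  · have h₀ := (((hasDerivAt_id t).div_const 2).sub (hpd t ht)).add
      ((hqd t ht).mul (hsd.const_mul (2 * c ^ 3)))
    have h := HasDerivAt.comp_of_eq (T t) (h₀.const_mul (-c ^ 2)) hlin (hinvT t).symm
    rw [hP, hQ, hPfun]
    refine HasDerivAt.congr_deriv h ?_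
    rw [hq' t ht, hp' t ht]
    linear_combination (4 * c ^ 3 * Real.sqrt (p t) * (p t - t / 2) + 1) * hc6
      + 4 * c ^ 6 * q t * hs
end

section
/- Let t, q ∈ ℝ and p > 0. Set T = −2^{−1/3}·t, Q = 2^{−1/6}·√p and P = −2^{−1/3}·( t/2 − p + q·√(2p) ). Then, with H_v(q,p,t) = p²/2 − (q² + t/2)p − v·q, one has the identity H_0(q,p,t) = −2^{−1/3}·[ 2·H_{1/2}(Q,P,T) + Q + T²/4 ]. Equivalently, setting H_{−1/2}(Q,P,T) = H_{1/2}(Q,P,T) + Q, one has H_0(q,p,t) + t²/8 = −2^{−1/3}·( H_{1/2}(Q,P,T) + H_{−1/2}(Q,P,T) ). -/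
/-- **Hamiltonian identity for Gambier's transformation of Painlevé II.**
With `T = -2^(-1/3) t`, `Q = 2^(-1/6) √p`, `P = -2^(-1/3)(t/2 - p + q √(2p))` and the
Painlevé II Hamiltonian `H_v(q,p,t) = p²/2 - (q² + t/2) p - v q`, one has
`H₀(q,p,t) = -2^(-1/3) [2 H_{1/2}(Q,P,T) + Q + T²/4]`, equivalently (with
`H_{-1/2} = H_{1/2} + Q`) `H₀(q,p,t) + t²/8 = -2^(-1/3)(H_{1/2} + H_{-1/2})`. -/
theorem painleveII_hamiltonian_identity
    (t q p : ℝ) (hp : 0 < p)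
    (T Q P : ℝ)
    (hT : T = -(2:ℝ) ^ (-1/3 : ℝ) * t)
    (hQ : Q = (2:ℝ) ^ (-1/6 : ℝ) * Real.sqrt p)
    (hP : P = -(2:ℝ) ^ (-1/3 : ℝ) * (t/2 - p + q * Real.sqrt (2 * p)))
    (H : ℝ → ℝ → ℝ → ℝ → ℝ)
    (hH : ∀ v x y s, H v x y s = y ^ 2 / 2 - (x ^ 2 + s/2) * y - v * x) :
    H 0 q p t = -(2:ℝ) ^ (-1/3 : ℝ) * (2 * H (1/2) Q P T + Q + T ^ 2 / 4) ∧
    H 0 q p t + t ^ 2 / 8 =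
      -(2:ℝ) ^ (-1/3 : ℝ) * (H (1/2) Q P T + (H (1/2) Q P T + Q)) := by
  have hc : ((2:ℝ) ^ (-1/3 : ℝ)) ^ 3 = 1 / 2 := by
    rw [← Real.rpow_natCast, ← Real.rpow_mul two_pos.le]
    norm_num [Real.rpow_neg_one]
  have hd : ((2:ℝ) ^ (-1/6 : ℝ)) ^ 2 = (2:ℝ) ^ (-1/3 : ℝ) := by
    rw [← Real.rpow_natCast, ← Real.rpow_mul two_pos.le]
    norm_num
  have hs : Real.sqrt (2 * p) ^ 2 = 2 * p := Real.sq_sqrt (by positivity)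
  have hQ2 : Q ^ 2 = (2:ℝ) ^ (-1/3 : ℝ) * p := by
    rw [hQ, mul_pow, hd, Real.sq_sqrt hp.le]
  simp only [hH, hQ2]
  clear hQ hQ2 hd hH
  subst hT hP
  generalize (2:ℝ) ^ (-1/3 : ℝ) = c at *
  generalize Real.sqrt (2 * p) = s at *
  have key : p ^ 2 / 2 - (q ^ 2 + t / 2) * p + t ^ 2 / 8 =
      -c ^ 3 * (q ^ 2 * s ^ 2 - (t / 2 - p) ^ 2) := by
    rw [hc, hs]; ring
  constructor
  · linear_combination key + t ^ 2 / 4 * hc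
  · linear_combination key
end

section
/- Let Q, P be differentiable complex-valued functions on a real interval J with 0 ∉ J, satisfying the Hamiltonian Painlevé III′ system with parameters v = (−1,0): T·Q' = 2Q²P − Q² + Q + T and T·P' = −2QP² + (2Q − 1)P + 1/2, and suppose Q(T) ≠ 0, Q(T)² ≠ T and Q(T)² ≠ −T for all T ∈ J. Define, via the change of variable t = 4T, the functions q(t) = −2TQ·( 2Q² − 4Q²P − Q − 2T ) / ( (Q² + T)(Q² − T) ) and p(t) = −(Q² − T)² / (4TQ²). Then (q,p) satisfies the Hamiltonian Painlevé III′ system with parameters v = (0,0): t·q' = 2q²p − q² + t and t·p' = −2qp² + 2qp. -/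
/-- A function whose rescaling `s ↦ f (4 * s)` is differentiable at `x` is differentiable
at `4 * x`. -/
theorem hasDerivAt_of_comp_four_mul {f : ℝ → ℂ} {f' : ℂ} {x : ℝ}
    (h : HasDerivAt (fun s => f (4 * s)) f' x) :
    HasDerivAt f ((4⁻¹ : ℝ) • f') (4 * x) := by
  have hx : (4 * x) / 4 = x := by ring
  have hlin : HasDerivAt (fun t : ℝ => t / 4) 4⁻¹ (4 * x) := by
    simpa using (hasDerivAt_id (4 * x)).div_const 4
  have hcomp := HasDerivAt.scomp (4 * x) (by rwa [hx]) hlin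
  refine hcomp.congr_of_eventuallyEq (.of_forall fun t => ?_)
  simp [mul_div_cancel₀]

/-- **The new transformation for Painlevé III′, inverse form, in canonical variables.**
If `(Q,P)` solves the Hamiltonian Painlevé III′ system with parameters `v = (-1,0)`,
with `Q ≠ 0` and `Q² ≠ ±T`, then under the change of variable `t = 4T` the functions
`q = -2TQ(2Q² - 4Q²P - Q - 2T)/((Q²+T)(Q²-T))` and `p = -(Q²-T)²/(4TQ²)` solve the
Hamiltonian Painlevé III′ system with parameters `v = (0,0)`. -/
theorem painleveIIIprime_W_inverse
    (J : Set ℝ) (hJ : J.OrdConnected) (h0J : (0:ℝ) ∉ J)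
    (Q P Q' P' : ℝ → ℂ)
    (hQd : ∀ T ∈ J, HasDerivAt Q (Q' T) T)
    (hPd : ∀ T ∈ J, HasDerivAt P (P' T) T)
    (hHQ : ∀ T ∈ J, (T : ℂ) * Q' T =
      2 * (Q T) ^ 2 * P T - (Q T) ^ 2 + Q T + (T : ℂ))
    (hHP : ∀ T ∈ J, (T : ℂ) * P' T =
      -2 * Q T * (P T) ^ 2 + (2 * Q T - 1) * P T + 1/2)
    (hQne : ∀ T ∈ J, Q T ≠ 0)
    (hQ2T : ∀ T ∈ J, (Q T) ^ 2 ≠ (T : ℂ))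
    (hQ2T' : ∀ T ∈ J, (Q T) ^ 2 ≠ -(T : ℂ))
    (q p : ℝ → ℂ)
    (hq : ∀ T : ℝ, q (4 * T) =
      -2 * (T : ℂ) * Q T * (2 * (Q T) ^ 2 - 4 * (Q T) ^ 2 * P T - Q T - 2 * (T : ℂ)) /
        (((Q T) ^ 2 + (T : ℂ)) * ((Q T) ^ 2 - (T : ℂ))))
    (hp : ∀ T : ℝ, p (4 * T) =
      -((Q T) ^ 2 - (T : ℂ)) ^ 2 / (4 * (T : ℂ) * (Q T) ^ 2)) :
    ∀ T ∈ J, ∃ dq dp : ℂ,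
      HasDerivAt q dq (4 * T) ∧ HasDerivAt p dp (4 * T) ∧
      ((4 * T : ℝ) : ℂ) * dq =
        2 * (q (4 * T)) ^ 2 * p (4 * T) - (q (4 * T)) ^ 2 + ((4 * T : ℝ) : ℂ) ∧
      ((4 * T : ℝ) : ℂ) * dp =
        -2 * q (4 * T) * (p (4 * T)) ^ 2 + 2 * q (4 * T) * p (4 * T) := by
  intro T hT
  have hT0 : (T : ℂ) ≠ 0 := fun h => h0J (Complex.ofReal_eq_zero.mp h ▸ hT)
  have hid : HasDerivAt (fun s : ℝ => (s : ℂ)) 1 T := Complex.ofRealCLM.hasDerivAt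
  have hQ0 := hQne T hT
  have hm : Q T ^ 2 - (T : ℂ) ≠ 0 := sub_ne_zero.mpr (hQ2T T hT)
  have hs : Q T ^ 2 + (T : ℂ) ≠ 0 := fun h => hQ2T' T hT (eq_neg_of_add_eq_zero_left h)
  have hden : 4 * (T : ℂ) * Q T ^ 2 ≠ 0 := by simp [hT0, hQ0]
  have hQ := hQd T hT
  have hP := hPd T hT
  have hQ' : Q' T = (2 * Q T ^ 2 * P T - Q T ^ 2 + Q T + T) / T := by
    rw [eq_div_iff hT0, mul_comm, hHQ T hT]
  have hP' : P' T = (-2 * Q T * P T ^ 2 + (2 * Q T - 1) * P T + 1 / 2) / T := by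
    rw [eq_div_iff hT0, mul_comm, hHP T hT]
  have hq_deriv := (((hid.const_mul (-2)).mul hQ).mul
    (((((hQ.pow 2).const_mul 2).sub (((hQ.pow 2).const_mul 4).mul hP)).sub hQ).sub
      (hid.const_mul 2))).div (((hQ.pow 2).add hid).mul ((hQ.pow 2).sub hid)) (mul_ne_zero hs hm)
  have hp_deriv := (((hQ.pow 2).sub hid).pow 2).neg.div ((hid.const_mul 4).mul (hQ.pow 2))
    hden
  refine ⟨_, _, hasDerivAt_of_comp_four_mul (hq_deriv.congr_of_eventuallyEq (.of_forall hq)),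
    hasDerivAt_of_comp_four_mul (hp_deriv.congr_of_eventuallyEq (.of_forall hp)), ?_, ?_⟩
  · rw [hq, hp, hQ', hP']
    simp only [Pi.add_apply, Pi.sub_apply, Pi.mul_apply, Pi.pow_apply, Complex.real_smul]
    push_cast
    field_simp
    ring
  · rw [hq, hp, hQ']
    simp only [Pi.sub_apply, Pi.mul_apply, Pi.pow_apply, Pi.neg_apply,
      Complex.real_smul]
    push_cast
    field_simp
    ring
end

section
/- Let q, a, b, c be complex numbers with a² − b² = 1 and c ≠ 0, and set p = a², t = c², T = t/4 (note a±b ≠ 0). Define the four pairs: Q_W = (ic/2)(a+b), P_W = (i/c)(1/2 + qab − ica)/(a+b); Q_S = (ic/2)(1/(a+b))·(1/2 + qab − icb)/(1/2 − qab + icb), P_S = −(i/c)(a+b)(1/2 − qab + ica); Q_E = −(ic/2)(a+b)[1 − 1/(1/2 + qab − icb) − 1/(1/2 + qab + ica)], P_E = −(i/c)(1/2 + qab + ica)/(a+b); Q_N = −(ic/2)(1/(a+b))·(1/2 + qab + ica)/(1/2 − qab − ica), P_N = (i/c)(1/2 − qab − ica)/(a−b); assuming the quantities 1/2 − qab + icb,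 1/2 + qab − icb, 1/2 + qab + ica and 1/2 − qab − ica are all nonzero. For a parameter pair (v₁,v₂) write 𝓗_{(v₁,v₂)}(Q,P) = Q²P² − (Q² + v₁Q − T)P + (1/2)(v₁+v₂)Q. Then 𝓗_{(−1,0)}(Q_W,P_W) + 𝓗_{(0,−1)}(Q_S,P_S) + 𝓗_{(1,0)}(Q_E,P_E) + 𝓗_{(0,1)}(Q_N,P_N) = q²p² − (q² − t)p − 1/4. (This is the additive Hamiltonian identity T·H_W(T) + T·H_S(T) + T·H_E(T) + T·H_N(T) = t·h(t) − 1/4.) -/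
/-- The polynomial Hamiltonian, multiplied by time, of the Painlevé III′ system at time `T`. -/
noncomputable def painleveHam (T v₁ v₂ Q P : ℂ) : ℂ :=
  Q ^ 2 * P ^ 2 - (Q ^ 2 + v₁ * Q - T) * P + (1/2) * (v₁ + v₂) * Q

section
variable {y s d : ℂ}

lemma painleveHam_west (hy : y ≠ 0) (hsd : s * d = 1) (k : ℂ) :
    painleveHam (-y ^ 2 / 4) (-1) 0 (y / 2 * s) (-1 / y * ((1/2 - k) * d)) =
      (1/2 - k) ^ 2 / 4 - (1/2 - k) / 2 + y * (s + d) * (1/2 - k) / 4 - y * s / 4 := by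
  have hQP : y / 2 * s * (-1 / y * ((1/2 - k) * d)) = -(1/2 - k) / 2 := by
    field_simp
    linear_combination (2 * k - 1) * hsd
  have hTP : -y ^ 2 / 4 * (-1 / y * ((1/2 - k) * d)) = y * d * (1/2 - k) / 4 := by
    field_simp
  generalize -1 / y * ((1/2 - k) * d) = P at *
  unfold painleveHam
  linear_combination (y / 2 * s * P - (1/2 - k) / 2 - y / 2 * s + 1) * hQP + hTP

lemma painleveHam_south (hy : y ≠ 0) (hsd : s * d = 1) {m : ℂ} (hm : 1/2 + m ≠ 0) :
    painleveHam (-y ^ 2 / 4) 0 (-1) (y / 2 * d * ((1/2 - m) / (1/2 + m)))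
        (-(-1 / y) * s * (1/2 + m + y * d)) =
      (1/2 - m) ^ 2 / 4 - y * d * (1/2 - m) / 4 - y * s * (1/2 + m + y * d) / 4 := by
  have hTP : -y ^ 2 / 4 * (-(-1 / y) * s * (1/2 + m + y * d)) =
      -(y * s * (1/2 + m + y * d)) / 4 := by
    field_simp
  obtain ⟨u, hu⟩ : ∃ u, u = (1/2 - m) / (1/2 + m) := ⟨_, rfl⟩
  have hum : u * (1/2 + m) = 1/2 - m := by rw [hu, div_mul_cancel₀ _ hm]
  rw [← hu]
  have hQP : y / 2 * d * u * (-(-1 / y) * s * (1/2 + m + y * d)) =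
      (1/2 - m) / 2 + y / 2 * d * u := by
    have : y / 2 * d * u * (-(-1 / y) * s * (1/2 + m + y * d)) =
        s * d * u * (1/2 + m + y * d) / 2 := by field_simp
    rw [this, hsd]
    linear_combination hum / 2
  generalize -(-1 / y) * s * (1/2 + m + y * d) = P at *
  unfold painleveHam
  linear_combination (y / 2 * d * u * P + (1/2 - m) / 2) * hQP + hTP - y * d / 4 * hum

lemma painleveHam_east (hy : y ≠ 0) (hsd : s * d = 1) {m n : ℂ} (hmn : m + n = y * s)
    (hm : 1/2 - m ≠ 0) (hn : 1/2 + n ≠ 0) :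
    painleveHam (-y ^ 2 / 4) 1 0 (-(y / 2) * s * (1 - 1 / (1/2 - m) - 1 / (1/2 + n)))
        (-(-1 / y) * ((1/2 + n) * d)) =
      ((1/2 + n) * (1/2 - m) - (1/2 + n) - (1/2 - m)) / 4 - y * d * (1/2 + n) / 4 := by
  have hTP : -y ^ 2 / 4 * (-(-1 / y) * ((1/2 + n) * d)) = -(y * d * (1/2 + n)) / 4 := by
    field_simp
  have hQP : ∀ r, -(y / 2) * s * r * (-(-1 / y) * ((1/2 + n) * d)) = -(1/2 + n) / 2 * r := by
    intro r
    have : -(y / 2) * s * r * (-(-1 / y) * ((1/2 + n) * d)) =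
        -(s * d * (1/2 + n)) / 2 * r := by field_simp
    rw [this, hsd, one_mul]
  obtain ⟨r, hr⟩ : ∃ r, r = 1 - 1 / (1/2 - m) - 1 / (1/2 + n) := ⟨_, rfl⟩
  have hrZ : r * ((1/2 - m) * (1/2 + n)) =
      (1/2 + n) * (1/2 - m) - (1/2 + n) - (1/2 - m) := by
    rw [hr]
    generalize 1/2 - m = β at *
    generalize 1/2 + n = α at *
    field_simp
  rw [← hr]
  specialize hQP r
  generalize -(-1 / y) * ((1/2 + n) * d) = P at *
  have hQ : -(y / 2) * s * r = -(m + n) / 2 * r := by rw [hmn]; ring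
  rw [hQ] at hQP ⊢
  unfold painleveHam
  linear_combination (-(m + n) / 2 * r * P - (1/2 + n) / 2 * r - (-(m + n) / 2 * r) - 1) * hQP
    + hTP + (r + 1) / 4 * hrZ

lemma painleveHam_north (hy : y ≠ 0) (hsd : s * d = 1) {n : ℂ} (hn : 1/2 - n ≠ 0) :
    painleveHam (-y ^ 2 / 4) 0 1 (-(y / 2) * d * ((1/2 + n) / (1/2 - n)))
        (-1 / y * ((1/2 - n) * s)) =
      (1/2 + n) ^ 2 / 4 - y * d * (1/2 + n) / 4 + y * s * (1/2 - n) / 4 := by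
  have hTP : -y ^ 2 / 4 * (-1 / y * ((1/2 - n) * s)) = y * s * (1/2 - n) / 4 := by
    field_simp
  obtain ⟨u, hu⟩ : ∃ u, u = (1/2 + n) / (1/2 - n) := ⟨_, rfl⟩
  have hun : u * (1/2 - n) = 1/2 + n := by rw [hu, div_mul_cancel₀ _ hn]
  rw [← hu]
  have hQP : -(y / 2) * d * u * (-1 / y * ((1/2 - n) * s)) = (1/2 + n) / 2 := by
    have : -(y / 2) * d * u * (-1 / y * ((1/2 - n) * s)) =
        s * d * (u * (1/2 - n)) / 2 := by field_simp
    rw [this, hsd, hun, one_mul]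
  generalize -1 / y * ((1/2 - n) * s) = P at *
  unfold painleveHam
  linear_combination (-(y / 2) * d * u * P + (1/2 + n) / 2 - (-(y / 2) * d * u)) * hQP + hTP
    - y * d / 4 * hun

end


/-- **Additive Hamiltonian identity for Painlevé III′.**
With `p = a²`, `t = c²`, `T = t/4` and the four transformed canonical pairs
`(Q_W,P_W), (Q_S,P_S), (Q_E,P_E), (Q_N,P_N)`, and with
`𝓗_{(v₁,v₂)}(Q,P) = Q²P² - (Q² + v₁Q - T)P + (1/2)(v₁+v₂)Q`, one has
`𝓗_{(-1,0)}(Q_W,P_W) + 𝓗_{(0,-1)}(Q_S,P_S) + 𝓗_{(1,0)}(Q_E,P_E)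
  + 𝓗_{(0,1)}(Q_N,P_N) = q²p² - (q² - t)p - 1/4`,
i.e. `T H_W + T H_S + T H_E + T H_N = t h - 1/4`. -/
theorem painleveIIIprime_hamiltonian_sum
    (q a b c : ℂ) (hab : a ^ 2 - b ^ 2 = 1) (hc : c ≠ 0)
    (p t T : ℂ) (hp : p = a ^ 2) (ht : t = c ^ 2) (hT : T = t / 4)
    (h1 : 1/2 - q * a * b + Complex.I * c * b ≠ 0)
    (h2 : 1/2 + q * a * b - Complex.I * c * b ≠ 0)
    (h3 : 1/2 + q * a * b + Complex.I * c * a ≠ 0)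
    (h4 : 1/2 - q * a * b - Complex.I * c * a ≠ 0)
    (QW PW QS PS QE PE QN PN : ℂ)
    (hQW : QW = Complex.I * c / 2 * (a + b))
    (hPW : PW = Complex.I / c * ((1/2 + q * a * b - Complex.I * c * a) / (a + b)))
    (hQS : QS = Complex.I * c / 2 * (1 / (a + b)) *
      ((1/2 + q * a * b - Complex.I * c * b) / (1/2 - q * a * b + Complex.I * c * b)))
    (hPS : PS = -(Complex.I / c) * (a + b) * (1/2 - q * a * b + Complex.I * c * a))
    (hQE : QE = -(Complex.I * c / 2) * (a + b) *
      (1 - 1 / (1/2 + q * a * b - Complex.I * c * b)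
         - 1 / (1/2 + q * a * b + Complex.I * c * a)))
    (hPE : PE = -(Complex.I / c) * ((1/2 + q * a * b + Complex.I * c * a) / (a + b)))
    (hQN : QN = -(Complex.I * c / 2) * (1 / (a + b)) *
      ((1/2 + q * a * b + Complex.I * c * a) / (1/2 - q * a * b - Complex.I * c * a)))
    (hPN : PN = Complex.I / c * ((1/2 - q * a * b - Complex.I * c * a) / (a - b)))
    (𝓗 : ℂ → ℂ → ℂ → ℂ → ℂ)
    (h𝓗 : ∀ v₁ v₂ Q P, 𝓗 v₁ v₂ Q P =
      Q ^ 2 * P ^ 2 - (Q ^ 2 + v₁ * Q - T) * P + (1/2) * (v₁ + v₂) * Q) :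
    𝓗 (-1) 0 QW PW + 𝓗 0 (-1) QS PS + 𝓗 1 0 QE PE + 𝓗 0 1 QN PN
      = q ^ 2 * p ^ 2 - (q ^ 2 - t) * p - 1/4 := by
  have hI : Complex.I ^ 2 = -1 := Complex.I_sq
  have hsd : (a + b) * (a - b) = 1 := by linear_combination hab
  have hd : 1 / (a + b) = a - b := by
    rw [div_eq_iff (left_ne_zero_of_mul_eq_one hsd)]; linear_combination -hsd
  have hs : 1 / (a - b) = a + b := by
    rw [div_eq_iff (right_ne_zero_of_mul_eq_one hsd)]; linear_combination -hsd
  obtain ⟨y, hy⟩ : ∃ y, y = Complex.I * c := ⟨_, rfl⟩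
  have hy0 : y ≠ 0 := hy ▸ mul_ne_zero Complex.I_ne_zero hc
  have hIc : Complex.I / c = -1 / y := by
    rw [div_eq_div_iff hc hy0, hy]; linear_combination c * hI
  have hty : t = -y ^ 2 := by
    rw [ht, hy]; linear_combination c ^ 2 * hI
  rw [div_eq_mul_one_div _ (a + b), hd, hIc] at hPW hPE
  rw [div_eq_mul_one_div _ (a - b), hs, hIc] at hPN
  rw [hd] at hQS hQN
  rw [hIc] at hPS
  rw [← hy] at h1 h2 h3 h4 hQW hPW hQS hPS hQE hPE hQN hPN
  obtain ⟨m, hm⟩ : ∃ m, m = y * b - q * a * b := ⟨_, rfl⟩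
  obtain ⟨n, hn⟩ : ∃ n, n = y * a + q * a * b := ⟨_, rfl⟩
  have e1 : 1/2 - q * a * b + y * b = 1/2 + m := by rw [hm]; ring
  have e2 : 1/2 + q * a * b - y * b = 1/2 - m := by rw [hm]; ring
  have e3 : 1/2 + q * a * b + y * a = 1/2 + n := by rw [hn]; ring
  have e4 : 1/2 - q * a * b - y * a = 1/2 - n := by rw [hn]; ring
  have e5 : 1/2 + q * a * b - y * a = 1/2 - (y * a - q * a * b) := by ring
  have e6 : 1/2 - q * a * b + y * a = 1/2 + m + y * (a - b) := by rw [hm]; ring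
  rw [e1] at h1 hQS
  rw [e2] at h2 hQS hQE
  rw [e3] at h3 hQE hPE hQN
  rw [e4] at h4 hQN hPN
  rw [e5] at hPW
  rw [e6] at hPS
  have h𝓗' : ∀ v₁ v₂ Q P, 𝓗 v₁ v₂ Q P = painleveHam (-y ^ 2 / 4) v₁ v₂ Q P := by
    intro v₁ v₂ Q P
    rw [h𝓗, hT, hty, painleveHam]
  rw [h𝓗', h𝓗', h𝓗', h𝓗', hQW, hPW, hQS, hPS, hQE, hPE, hQN, hPN,
    painleveHam_west hy0 hsd, painleveHam_south hy0 hsd h1,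
    painleveHam_east hy0 hsd (by rw [hm, hn]; ring) h2 h3,
    painleveHam_north hy0 hsd h4, hp, hty, hm, hn]
  linear_combination (-q ^ 2 * a ^ 2) * hab
end
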